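/- Adding denotations (linearity of the denotational semantics): let C̄ be a command sequence, Q a finite set of qubits, ψ₀ and ψ₁ vectors over Q, and S a store, and suppose tᵢ = ⟦C̄⟧((Q, ψᵢ), S) is defined for i = 0, 1. Then t₀ and t₁ have the same tree shape, ⟦C̄⟧((Q, ψ₀ + ψ₁), S) is defined, and it equals the tree of that common shape whose leaf at each position is Leaf(a₀ + a₁), where Leaf(aᵢ) is the leaf of tᵢ at the same position (in particular every such resource sum a₀ + a₁ is defined). -/

import Mathlib

open scoped Classical

noncomputable section

namespace QSL

/-! ## Resources -/

/-- Vectors over the Hilbert space with orthonormal basis indexed by `Q → {0,1}`. -/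
def Vec {Qubit : Type} (Q : Finset Qubit) : Type := ({ q // q ∈ Q } → Bool) → ℂ

/-- A quantum state: a finite set of qubits together with a vector over them. -/
def QState (Qubit : Type) : Type := Σ Q : Finset Qubit, Vec Q

/-- A store: a partial function from variables to values. -/
def Store (Var Val : Type) : Type := Var → Option Val

/-- A resource: a quantum state together with a store. -/
def Res (Qubit Var Val : Type) : Type := QState Qubit × Store Var Val

variable {Qubit Var Val : Type}

/-- Tensor product of vectors over disjoint qubit sets. -/
def tensorVec {Q Q' : Finset Qubit} (v : Vec Q) (w : Vec Q') : Vec (Q ∪ Q') := fun f =>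
  v (fun q => f ⟨q.1, Finset.mem_union_left _ q.2⟩) *
  w (fun q => f ⟨q.1, Finset.mem_union_right _ q.2⟩)

/-- Transport of a vector along an equality of qubit sets. -/
def castVec {Q Q' : Finset Qubit} (h : Q = Q') (v : Vec Q) : Vec Q' := h ▸ v

/-- The empty quantum state with scalar 1. -/
def unitQ : QState Qubit := ⟨(∅ : Finset Qubit), fun _ => 1⟩

/-- The unit resource: empty qubit set with scalar 1 and the empty store. -/
def unitRes : Res Qubit Var Val := (unitQ, fun _ => none)

/-- Partial product of resources: defined iff the qubit sets are disjoint and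
the store domains are disjoint; takes the union of qubit sets, tensor product of
vectors, and union of stores. -/
def rmul (a b : Res Qubit Var Val) : Option (Res Qubit Var Val) :=
  if h : Disjoint a.1.1 b.1.1 ∧ ∀ x, a.2 x = none ∨ b.2 x = none then
    some (⟨a.1.1 ∪ b.1.1, tensorVec a.1.2 b.1.2⟩, fun x => a.2 x <|> b.2 x)
  else none

/-- Partial sum of resources: defined iff the two resources have the same
qubit set and the same store; adds the vectors. -/
def radd (a b : Res Qubit Var Val) : Option (Res Qubit Var Val) :=
  if h : a.1.1 = b.1.1 ∧ a.2 = b.2 then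
    some (⟨b.1.1, fun f => castVec h.1 a.1.2 f + b.1.2 f⟩, b.2)
  else none

/-- Incompatibility of resources: some variable lies in both store domains and
the stores disagree on it. -/
def incompat (a b : Res Qubit Var Val) : Prop :=
  ∃ x u u', a.2 x = some u ∧ b.2 x = some u' ∧ u ≠ u'

/-! ## The programming language (values are natural numbers) -/

/-- Pure expressions: constants, variables, operations applied to subexpressions. -/
inductive Expr (Var : Type) : Type
  | const : ℕ → Expr Var
  | evar : Var → Expr Var
  | op : (n : ℕ) → ((Fin n → ℕ) → ℕ) → (Fin n → Expr Var) → Expr Var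

/-- Evaluation of a pure expression in a store; undefined on variables outside
the store's domain. -/
def Expr.eval {Var : Type} (S : Store Var ℕ) : Expr Var → Option ℕ
  | .const n => some n
  | .evar x => S x
  | .op n f es =>
      if h : ∀ i, (Expr.eval S (es i)).isSome then
        some (f (fun i => (Expr.eval S (es i)).get (h i)))
      else none

/-- A unitary operator on `n` qubits, as a matrix with orthonormal columns. -/
structure UnitaryOp (n : ℕ) : Type where
  mat : (Fin n → Bool) → (Fin n → Bool) → ℂ
  unitary : ∀ a b, (∑ c : Fin n → Bool, (starRingEnd ℂ) (mat c a) * mat c b) =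
    if a = b then 1 else 0

/-- A measurement: a finite family of linear operators `M⁽ⁱ⁾` on `n` qubits
with `Σᵢ (M⁽ⁱ⁾)† M⁽ⁱ⁾ = I`. -/
structure MeasOp (k n : ℕ) : Type where
  ops : Fin k → (Fin n → Bool) → (Fin n → Bool) → ℂ
  complete : ∀ a b,
    (∑ i : Fin k, ∑ c : Fin n → Bool, (starRingEnd ℂ) (ops i c a) * ops i c b) =
      if a = b then 1 else 0


/-- Apply an operator (given by its matrix) to the designated qubits of a
quantum state; defined iff the designated qubits are distinct and all present. -/
def applyOp {n : ℕ} (mat : (Fin n → Bool) → (Fin n → Bool) → ℂ) (qs : Fin n → Qubit)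
    (ψ : QState Qubit) : Option (QState Qubit) :=
  if h : Function.Injective qs ∧ ∀ i, qs i ∈ ψ.1 then
    some ⟨ψ.1, fun g => ∑ b : Fin n → Bool,
      mat (fun i => g ⟨qs i, h.2 i⟩) b *
      ψ.2 (fun q => if h' : ∃ i, qs i = q.1 then b h'.choose else g q)⟩
  else none

/-- Commands of the language. -/
inductive Cmd (Qubit Var : Type) : Type
  | skip
  | seq (c c' : Cmd Qubit Var)
  | ite (e : Expr Var) (c1 c0 : Cmd Qubit Var)
  | whileC (e : Expr Var) (c : Cmd Qubit Var)
  | assign (x : Var) (e : Expr Var)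
  | unitary (n : ℕ) (U : UnitaryOp n) (qs : Fin n → Qubit)
  | measure (x : Var) (k n : ℕ) (M : MeasOp k n) (qs : Fin n → Qubit)

/-! ## Behaviour trees (represented as partial labelling functions on paths) -/

/-- Node labels of behaviour trees. -/
inductive BLabel (Qubit Var : Type) : Type
  | branch (k : ℕ)
  | leaf (a : Res Qubit Var ℕ)
  | nil

/-- Behaviour trees, represented by their partial labelling function on paths. -/
def BTree (Qubit Var : Type) : Type := List ℕ → Option (BLabel Qubit Var)

/-- The tree `Nil`. -/
def nilTree : BTree Qubit Var := fun p => if p = [] then some BLabel.nil else none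

/-- The tree `Leaf a`. -/
def leafTree (a : Res Qubit Var ℕ) : BTree Qubit Var :=
  fun p => if p = [] then some (BLabel.leaf a) else none

/-- The tree `Branch` with `k` children. -/
def branchTree (k : ℕ) (child : Fin k → BTree Qubit Var) : BTree Qubit Var := fun p =>
  match p with
  | [] => some (BLabel.branch k)
  | i :: p' => if h : i < k then child ⟨i, h⟩ p' else none

/-- Iterated child access `t.ī`. -/
def BTree.access (t : BTree Qubit Var) (is : List ℕ) : BTree Qubit Var :=
  fun p => t (is ++ p)

/-- Branching of partially-defined children: defined iff all children are. -/
def branchOpt (k : ℕ) (f : Fin k → Option (BTree Qubit Var)) : Option (BTree Qubit Var) :=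
  if h : ∀ i, (f i).isSome then some (branchTree k (fun i => (f i).get (h i))) else none

/-- Store update. -/
def updStore (S : Store Var ℕ) (x : Var) (v : ℕ) : Store Var ℕ :=
  fun y => if y = x then some v else S y

/-! ## Denotational semantics -/

/-- The `n`-th approximation of the denotational semantics, rendering
computations unfinished after `n` unfolding steps as `Nil`. -/
def semN : ℕ → List (Cmd Qubit Var) → QState Qubit → Store Var ℕ → Option (BTree Qubit Var)
  | 0, _, _, _ => some nilTree
  | _ + 1, [], ψ, S => some (leafTree (ψ, S))
  | n + 1, Cmd.skip :: cs, ψ, S => semN n cs ψ S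
  | n + 1, Cmd.seq c c' :: cs, ψ, S => semN n (c :: c' :: cs) ψ S
  | n + 1, Cmd.ite e c1 c0 :: cs, ψ, S =>
      match Expr.eval S e with
      | some 1 => semN n (c1 :: cs) ψ S
      | some 0 => semN n (c0 :: cs) ψ S
      | _ => none
  | n + 1, Cmd.whileC e c :: cs, ψ, S =>
      semN n (Cmd.ite e (Cmd.seq c (Cmd.whileC e c)) Cmd.skip :: cs) ψ S
  | n + 1, Cmd.assign x e :: cs, ψ, S =>
      match S x, Expr.eval S e with
      | some _, some v => semN n cs ψ (updStore S x v)
      | _, _ => none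
  | n + 1, Cmd.unitary nq U qs :: cs, ψ, S =>
      match applyOp U.mat qs ψ with
      | some ψ' => semN n cs ψ' S
      | none => none
  | n + 1, Cmd.measure x k nq M qs :: cs, ψ, S =>
      match S x with
      | some _ =>
          branchOpt k (fun i =>
            (applyOp (M.ops i) qs ψ).bind (fun ψ' => semN n cs ψ' (updStore S x i.1)))
      | none => none

/-- The denotational semantics: defined iff all approximations are, and then
the limit (least upper bound) of the ω-chain of approximations. -/
def sem (cs : List (Cmd Qubit Var)) (ψ : QState Qubit) (S : Store Var ℕ) :
    Option (BTree Qubit Var) :=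
  if h : ∀ n, (semN n cs ψ S).isSome then
    some (fun p =>
      if h1 : ∃ n l, ((semN n cs ψ S).get (h n)) p = some l ∧ l ≠ BLabel.nil then
        some h1.choose_spec.choose
      else if ∃ n, ((semN n cs ψ S).get (h n)) p = some BLabel.nil then some BLabel.nil
      else none)
  else none

/-- Sum of vectors. -/
def addVec {Q : Finset Qubit} (v w : Vec Q) : Vec Q := fun f => v f + w f

/-- Labels of the three trees at one position. -/
inductive LRel : Option (BLabel Qubit Var) → Option (BLabel Qubit Var) →
    Option (BLabel Qubit Var) → Prop
  | none : LRel none none none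
  | branch (k : ℕ) : LRel (some (.branch k)) (some (.branch k)) (some (.branch k))
  | nil : LRel (some .nil) (some .nil) (some .nil)
  | leaf (a b s : Res Qubit Var ℕ) (h : radd a b = some s) :
      LRel (some (.leaf a)) (some (.leaf b)) (some (.leaf s))

theorem applyOp_cases {n : ℕ} (mat : (Fin n → Bool) → (Fin n → Bool) → ℂ)
    (qs : Fin n → Qubit) (Q : Finset Qubit) :
    (∀ v : Vec Q, applyOp mat qs ⟨Q, v⟩ = none) ∨
    ∃ L : Vec Q → Vec Q, (∀ v w : Vec Q, L (addVec v w) = addVec (L v) (L w)) ∧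
      ∀ v : Vec Q, applyOp mat qs ⟨Q, v⟩ = some ⟨Q, L v⟩ := by
  by_cases h : Function.Injective qs ∧ ∀ i, qs i ∈ Q
  · right
    refine ⟨fun v g => ∑ b : Fin n → Bool,
      mat (fun i => g ⟨qs i, h.2 i⟩) b *
      v (fun q => if h' : ∃ i, qs i = q.1 then b h'.choose else g q), ?_, ?_⟩
    · intro v w
      funext g
      simp only [addVec, mul_add, Finset.sum_add_distrib]
    · intro v
      exact dif_pos h
  · left
    intro v
    exact dif_neg h

theorem branchOpt_some {k : ℕ} {f : Fin k → Option (BTree Qubit Var)} {t : BTree Qubit Var} :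
    branchOpt k f = some t ↔ ∃ c : Fin k → BTree Qubit Var,
      (∀ i, f i = some (c i)) ∧ t = branchTree k c := by
  unfold branchOpt
  constructor
  · intro h
    split_ifs at h with h1
    simp only [Option.some.injEq] at h
    exact ⟨fun i => (f i).get (h1 i), fun i => by simp, h.symm⟩
  · rintro ⟨c, hc, rfl⟩
    have h1 : ∀ i, (f i).isSome := fun i => by simp [hc]
    rw [dif_pos h1]
    congr 2
    funext i
    simp [hc]

theorem semN_add (n : ℕ) : ∀ (cs : List (Cmd Qubit Var)) (Q : Finset Qubit) (v w : Vec Q)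
    (S : Store Var ℕ) (t₀ t₁ : BTree Qubit Var),
    semN n cs ⟨Q, v⟩ S = some t₀ → semN n cs ⟨Q, w⟩ S = some t₁ →
    ∃ t, semN n cs ⟨Q, addVec v w⟩ S = some t ∧ ∀ p, LRel (t₀ p) (t₁ p) (t p) := by
  induction n with
  | zero =>
    intro cs Q v w S t₀ t₁ h0 h1
    simp only [semN, Option.some.injEq] at h0 h1 ⊢
    subst h0 h1
    refine ⟨_, rfl, fun p => ?_⟩
    unfold nilTree
    split_ifs <;> constructor
  | succ n ih =>
    intro cs Q v w S t₀ t₁ h0 h1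
    rcases cs with _ | ⟨c, cs⟩
    · simp only [semN, Option.some.injEq] at h0 h1 ⊢
      subst h0 h1
      refine ⟨_, rfl, fun p => ?_⟩
      unfold leafTree
      split_ifs
      · constructor
        simp [radd, castVec]
        rfl
      · constructor
    · cases c with
      | skip => simp only [semN] at h0 h1 ⊢; exact ih _ _ _ _ _ _ _ h0 h1
      | seq c c' => simp only [semN] at h0 h1 ⊢; exact ih _ _ _ _ _ _ _ h0 h1
      | ite e c1 c0 =>
        simp only [semN] at h0 h1 ⊢
        split at h0 <;> rename_i he
        · rw [he] at h1; exact ih _ _ _ _ _ _ _ h0 h1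
        · rw [he] at h1; exact ih _ _ _ _ _ _ _ h0 h1
        · cases h0
      | whileC e c => simp only [semN] at h0 h1 ⊢; exact ih _ _ _ _ _ _ _ h0 h1
      | assign x e =>
        simp only [semN] at h0 h1 ⊢
        split at h0
        · rename_i hx he
          rw [hx, he] at h1; exact ih _ _ _ _ _ _ _ h0 h1
        · cases h0
      | unitary nq U qs =>
        simp only [semN] at h0 h1 ⊢
        rcases applyOp_cases U.mat qs Q with hn | ⟨L, hL, hs⟩
        · rw [hn] at h0; cases h0
        · rw [hs] at h0 h1 ⊢
          rw [hL]
          exact ih _ _ _ _ _ _ _ h0 h1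
      | measure x k nq M qs =>
        simp only [semN] at h0 h1 ⊢
        split at h0
        · rename_i hx
          rw [hx] at h1
          simp only [] at h1
          obtain ⟨c0, hc0, rfl⟩ := branchOpt_some.1 h0
          obtain ⟨c1, hc1, rfl⟩ := branchOpt_some.1 h1
          have key : ∀ i, ∃ t, ((applyOp (M.ops i) qs ⟨Q, addVec v w⟩).bind
              (fun ψ' => semN n cs ψ' (updStore S x i.1))) = some t ∧
              ∀ p, LRel (c0 i p) (c1 i p) (t p) := by
            intro i
            have a0 := hc0 i
            have a1 := hc1 i
            rcases applyOp_cases (M.ops i) qs Q with hn | ⟨L, hL, hs⟩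
            · rw [hn] at a0; cases a0
            · rw [hs] at a0 a1 ⊢
              rw [hL]
              exact ih _ _ _ _ _ _ _ a0 a1
          choose c hc hr using key
          refine ⟨_, branchOpt_some.2 ⟨c, hc, rfl⟩, fun p => ?_⟩
          rcases p with _ | ⟨i, p⟩
          · exact LRel.branch k
          · simp only [branchTree]
            split_ifs with hi
            · exact hr _ _
            · exact LRel.none
        · cases h0

theorem semN_mono_succ (n : ℕ) : ∀ (cs : List (Cmd Qubit Var)) (ψ : QState Qubit)
    (S : Store Var ℕ) (t t' : BTree Qubit Var),
    semN n cs ψ S = some t → semN (n + 1) cs ψ S = some t' →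
    ∀ p l, t p = some l → l ≠ BLabel.nil → t' p = some l := by
  induction n with
  | zero =>
    intro cs ψ S t t' h0 h1 p l hp hl
    simp only [semN, Option.some.injEq] at h0
    subst h0
    unfold nilTree at hp
    split_ifs at hp
    cases hp
    exact absurd rfl hl
  | succ n ih =>
    intro cs ψ S t t' h0 h1
    rcases cs with _ | ⟨c, cs⟩
    · rw [semN] at h0 h1
      cases h0; cases h1
      exact fun p l hp _ => hp
    · cases c with
      | skip => rw [semN] at h0 h1; exact ih _ _ _ _ _ h0 h1
      | seq c c' => rw [semN] at h0 h1; exact ih _ _ _ _ _ h0 h1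
      | ite e c1 c0 =>
        rw [semN] at h0 h1
        split at h0
        · exact ih _ _ _ _ _ h0 (by simpa [*] using h1)
        · exact ih _ _ _ _ _ h0 (by simpa [*] using h1)
        · cases h0
      | whileC e c => rw [semN] at h0 h1; exact ih _ _ _ _ _ h0 h1
      | assign x e =>
        rw [semN] at h0 h1
        split at h0
        · exact ih _ _ _ _ _ h0 (by simpa [*] using h1)
        · cases h0
      | unitary nq U qs =>
        rw [semN] at h0 h1
        split at h0
        · exact ih _ _ _ _ _ h0 (by simpa [*] using h1)
        · cases h0
      | measure x k nq M qs =>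
        rw [semN] at h0 h1
        split at h0
        · rename_i hx
          rw [hx] at h1
          simp only [] at h1
          obtain ⟨c0, hc0, rfl⟩ := branchOpt_some.1 h0
          obtain ⟨c1, hc1, rfl⟩ := branchOpt_some.1 h1
          intro p l hp hl
          rcases p with _ | ⟨i, p⟩
          · exact hp
          · simp only [branchTree] at hp ⊢
            split_ifs at hp ⊢ with hi
            have a0 := hc0 ⟨i, hi⟩
            have a1 := hc1 ⟨i, hi⟩
            rcases hA : applyOp (M.ops ⟨i, hi⟩) qs ψ with _ | ψ'
            · rw [hA] at a0; cases a0
            · rw [hA] at a0 a1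
              exact ih _ _ _ _ _ a0 a1 p l hp hl
        · cases h0

theorem sem_char {cs : List (Cmd Qubit Var)} {ψ : QState Qubit} {S : Store Var ℕ}
    {u : ℕ → BTree Qubit Var} (hu : ∀ n, semN n cs ψ S = some (u n)) :
    ∃ t, sem cs ψ S = some t ∧ ∀ p,
      (∀ n l, u n p = some l → l ≠ BLabel.nil → t p = some l) ∧
      ((∀ n l, u n p = some l → l = BLabel.nil) → ∀ n, u n p = some BLabel.nil →
        t p = some BLabel.nil) ∧
      ((∀ n, u n p = none) → t p = none) := by
  have h : ∀ n, (semN n cs ψ S).isSome := fun n => by simp [hu]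
  have hg : ∀ n, (semN n cs ψ S).get (h n) = u n := fun n => by simp [hu]
  have mono : ∀ p l, l ≠ BLabel.nil → ∀ n m, n ≤ m → u n p = some l → u m p = some l := by
    intro p l hl n m hnm hp
    induction m, hnm using Nat.le_induction with
    | base => exact hp
    | succ m _ ih => exact semN_mono_succ m cs ψ S _ _ (hu m) (hu (m + 1)) p l ih hl
  refine ⟨_, dif_pos h, fun p => ⟨?_, ?_, ?_⟩⟩
  · intro n l hp hl
    have h1 : ∃ n l, ((semN n cs ψ S).get (h n)) p = some l ∧ l ≠ BLabel.nil :=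
      ⟨n, l, by rw [hg]; exact hp, hl⟩
    simp only [dif_pos h1]
    have h2 := h1.choose_spec.choose_spec
    have h3 := (congrFun (hg h1.choose) p).symm.trans h2.1
    have e1 := mono p _ h2.2 _ _ (le_max_left h1.choose n) h3
    have e2 := mono p l hl _ _ (le_max_right h1.choose n) hp
    rw [← e1, e2]
  · intro hall n hp
    have h1 : ¬ ∃ n l, ((semN n cs ψ S).get (h n)) p = some l ∧ l ≠ BLabel.nil := by
      rintro ⟨n, l, a, b⟩
      rw [hg] at a
      exact b (hall n l a)
    have h2 : ∃ n, ((semN n cs ψ S).get (h n)) p = some BLabel.nil := ⟨n, by rw [hg]; exact hp⟩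
    simp only [dif_neg h1, if_pos h2]
  · intro hall
    have h1 : ¬ ∃ n l, ((semN n cs ψ S).get (h n)) p = some l ∧ l ≠ BLabel.nil := by
      rintro ⟨n, l, a, b⟩
      rw [hg, hall] at a
      cases a
    have h2 : ¬ ∃ n, ((semN n cs ψ S).get (h n)) p = some BLabel.nil := by
      rintro ⟨n, a⟩
      rw [hg, hall] at a
      cases a
    simp only [dif_neg h1, if_neg h2]

theorem sem_approx {cs : List (Cmd Qubit Var)} {ψ : QState Qubit} {S : Store Var ℕ}
    {t : BTree Qubit Var} (h : sem cs ψ S = some t) :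
    ∃ u : ℕ → BTree Qubit Var, ∀ n, semN n cs ψ S = some (u n) := by
  unfold sem at h
  split_ifs at h with h1
  exact ⟨fun n => (semN n cs ψ S).get (h1 n), fun n => by simp⟩

/-- Adding denotations (linearity of the denotational semantics). -/
theorem denosem_add {Qubit Var : Type} (cs : List (Cmd Qubit Var))
    (Q : Finset Qubit) (ψ₀ ψ₁ : Vec Q) (S : Store Var ℕ) (t₀ t₁ : BTree Qubit Var)
    (h₀ : sem cs ⟨Q, ψ₀⟩ S = some t₀) (h₁ : sem cs ⟨Q, ψ₁⟩ S = some t₁) :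
    ∃ t, sem cs ⟨Q, fun f => ψ₀ f + ψ₁ f⟩ S = some t ∧
      ∀ p : List ℕ,
        (t₀ p = none → t₁ p = none ∧ t p = none)
        ∧ (∀ k, t₀ p = some (BLabel.branch k) →
            t₁ p = some (BLabel.branch k) ∧ t p = some (BLabel.branch k))
        ∧ (t₀ p = some BLabel.nil → t₁ p = some BLabel.nil ∧ t p = some BLabel.nil)
        ∧ (∀ a₀, t₀ p = some (BLabel.leaf a₀) →
            ∃ a₁ s, t₁ p = some (BLabel.leaf a₁) ∧ radd a₀ a₁ = some s ∧
              t p = some (BLabel.leaf s)) := by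
  obtain ⟨u₀, hu₀⟩ := sem_approx h₀
  obtain ⟨u₁, hu₁⟩ := sem_approx h₁
  choose u hu hr using fun n => semN_add n cs Q ψ₀ ψ₁ S _ _ (hu₀ n) (hu₁ n)
  obtain ⟨t₀', e₀, c₀⟩ := sem_char hu₀
  obtain ⟨t₁', e₁, c₁⟩ := sem_char hu₁
  obtain ⟨t, e, c⟩ := sem_char (ψ := ⟨Q, addVec ψ₀ ψ₁⟩) hu
  rw [h₀] at e₀
  rw [h₁] at e₁
  cases e₀
  cases e₁
  refine ⟨t, e, fun p => ?_⟩
  have key : LRel (t₀ p) (t₁ p) (t p) := by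
    by_cases hA : ∃ n l, u₀ n p = some l ∧ l ≠ BLabel.nil
    · obtain ⟨n, l, hl, hne⟩ := hA
      have hrn := hr n p
      generalize hx : u₀ n p = x at hrn
      generalize hy : u₁ n p = y at hrn
      generalize hz : u n p = z at hrn
      cases hrn with
      | none => rw [hx] at hl; cases hl
      | nil => rw [hx] at hl; cases hl; exact absurd rfl hne
      | branch k =>
        rw [(c₀ p).1 n _ hx (by simp), (c₁ p).1 n _ hy (by simp), (c p).1 n _ hz (by simp)]
        exact LRel.branch k
      | leaf a b s h =>
        rw [(c₀ p).1 n _ hx (by simp), (c₁ p).1 n _ hy (by simp), (c p).1 n _ hz (by simp)]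
        exact LRel.leaf a b s h
    · have hall : ∀ n, (u₀ n p = none ∧ u₁ n p = none ∧ u n p = none) ∨
          (u₀ n p = some .nil ∧ u₁ n p = some .nil ∧ u n p = some .nil) := by
        intro n
        have hrn := hr n p
        generalize hx : u₀ n p = x at hrn
        generalize hy : u₁ n p = y at hrn
        generalize hz : u n p = z at hrn
        cases hrn with
        | none => simp
        | nil => simp
        | branch k => exact absurd ⟨n, _, hx, by simp⟩ hA
        | leaf a b s h => exact absurd ⟨n, _, hx, by simp⟩ hA
      by_cases hB : ∃ n, u₀ n p = some BLabel.nil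
      · obtain ⟨n, hn⟩ := hB
        have hn1 : u₁ n p = some .nil ∧ u n p = some .nil := by
          rcases hall n with h | h
          · rw [h.1] at hn; cases hn
          · exact h.2
        rw [(c₀ p).2.1 (fun m l hm => by rcases hall m with h | h <;> simp_all) n hn,
          (c₁ p).2.1 (fun m l hm => by rcases hall m with h | h <;> simp_all) n hn1.1,
          (c p).2.1 (fun m l hm => by rcases hall m with h | h <;> simp_all) n hn1.2]
        exact LRel.nil
      · have hnn : ∀ n, u₀ n p = none ∧ u₁ n p = none ∧ u n p = none := fun n =>
          (hall n).resolve_right (fun h => hB ⟨n, h.1⟩)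
        rw [(c₀ p).2.2 (fun m => (hnn m).1), (c₁ p).2.2 (fun m => (hnn m).2.1),
          (c p).2.2 (fun m => (hnn m).2.2)]
        exact LRel.none
  generalize t₀ p = x at key ⊢
  generalize t₁ p = y at key ⊢
  generalize t p = z at key ⊢
  cases key with
  | none => simp
  | nil => simp
  | branch k => simp
  | leaf a b s h => simp [h]
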